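/- Let ρ be a nontrivial zero of the Riemann zeta function with Re(ρ) < 1/2, and let ε be a real number with 0 < ε < 1/2 − Re(ρ). Then there exists a constant C > 0 such that for every positive integer l and every real x > 0: if 0 < x ≤ 1 then |∫_{1/2}^∞ g_ρ(x·t)·sin((2l+1)πt)/(πt) dt| ≤ C·x^{−Re(ρ)−ε}/(2l+1)², and if x > 1 then |∫_{1/2}^∞ g_ρ(x·t)·sin((2l+1)πt)/(πt) dt| ≤ C·x^{−1}/(2l+1)². -/

import Mathlib

open MeasureTheory Real Filter

/-- The function `η(x) = 8πx²(πx² − 3/2)e^{−πx²}`. -/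
noncomputable def eta (x : ℝ) : ℝ :=
  8 * π * x ^ 2 * (π * x ^ 2 - 3 / 2) * Real.exp (-π * x ^ 2)

/-- `g ρ = Z⁻¹ F_ρ`, given by `g ρ t = ∫₁^∞ η(u·t)·u^{ρ−1} du`. -/
noncomputable def g (ρ : ℂ) (t : ℝ) : ℂ :=
  ∫ u in Set.Ioi (1 : ℝ), (eta (u * t) : ℂ) * (u : ℂ) ^ (ρ - 1)

/-- `F_ρ x = ∫₁^∞ (Σ_{n≥1} η(n·t·x))·t^{ρ−1} dt`. -/
noncomputable def F (ρ : ℂ) (x : ℝ) : ℂ :=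
  ∫ t in Set.Ioi (1 : ℝ), (∑' n : ℕ, (eta (((n : ℝ) + 1) * t * x) : ℂ)) * (t : ℂ) ^ (ρ - 1)

/-- `δ_{l,ρ}(x) = ∫₀^∞ g ρ (x·t)·sin((2l+1)πt)/(πt) dt`. -/
noncomputable def delta (l : ℕ) (ρ : ℂ) (x : ℝ) : ℂ :=
  ∫ t in Set.Ioi (0 : ℝ),
    g ρ (x * t) * ((Real.sin ((2 * (l : ℝ) + 1) * π * t) / (π * t) : ℝ) : ℂ)

/-- The Fourier transform `𝔉f(y) = ∫_ℝ f(x)·e^{2πixy} dx`. -/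
noncomputable def FT (f : ℝ → ℂ) (y : ℝ) : ℂ :=
  ∫ x : ℝ, f x * Complex.exp (((2 * π * x * y : ℝ) : ℂ) * Complex.I)

lemma rpow_le_two_add_pi_mul_sq {β s : ℝ} (hβ0 : 0 ≤ β) (hβ1 : β ≤ 1) (hs : 0 < s) :
    s ^ β ≤ 2 + π * s ^ 2 := by
  have hπ : 1 ≤ π := by linarith [Real.pi_gt_three]
  have hsq : s ^ 2 ≤ π * s ^ 2 := le_mul_of_one_le_left (sq_nonneg s) hπ
  rcases le_total s 1 with h | h
  · linarith [Real.rpow_le_one hs.le h hβ0, sq_nonneg s]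
  · have := Real.rpow_le_rpow_of_exponent_le h hβ1
    rw [Real.rpow_one] at this
    nlinarith

/-- Any quantity dominated by a cubic in `πs²` times the Gaussian is `O(s^{-β})`. -/
lemma le_mul_rpow_neg_of_le_cubic_mul_exp {β s A K : ℝ} (hβ0 : 0 ≤ β) (hβ1 : β ≤ 1)
    (hs : 0 < s) (hK : 0 ≤ K) (hA : A ≤ K * (1 + π * s ^ 2) ^ 3 * Real.exp (-π * s ^ 2)) :
    A ≤ K * (48 * Real.exp 1) * s ^ (-β) := by
  have hy : 0 ≤ π * s ^ 2 := by positivity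
  have hpow := Real.pow_div_factorial_le_exp (1 + π * s ^ 2) (by linarith) 4
  rw [div_le_iff₀ (by positivity), Real.exp_add] at hpow
  norm_num [Nat.factorial] at hpow
  have hmul : (1 + π * s ^ 2) ^ 3 * Real.exp (-π * s ^ 2) * s ^ β ≤ 48 * Real.exp 1 := by
    calc (1 + π * s ^ 2) ^ 3 * Real.exp (-π * s ^ 2) * s ^ β
        ≤ (1 + π * s ^ 2) ^ 3 * Real.exp (-π * s ^ 2) * (2 * (1 + π * s ^ 2)) := by
          gcongr
          linarith [rpow_le_two_add_pi_mul_sq hβ0 hβ1 hs]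
      _ = 2 * ((1 + π * s ^ 2) ^ 4 * Real.exp (-π * s ^ 2)) := by ring
      _ ≤ 2 * (Real.exp 1 * Real.exp (π * s ^ 2) * 24 * Real.exp (-π * s ^ 2)) := by gcongr
      _ = 48 * Real.exp 1 * (Real.exp (π * s ^ 2) * Real.exp (-π * s ^ 2)) := by ring
      _ = 48 * Real.exp 1 := by rw [← Real.exp_add]; simp
  rw [Real.rpow_neg hs.le, ← div_eq_mul_inv, le_div_iff₀ (by positivity)]
  calc A * s ^ β ≤ K * (1 + π * s ^ 2) ^ 3 * Real.exp (-π * s ^ 2) * s ^ β := by gcongr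
    _ = K * ((1 + π * s ^ 2) ^ 3 * Real.exp (-π * s ^ 2) * s ^ β) := by ring
    _ ≤ K * (48 * Real.exp 1) := by gcongr

lemma abs_eta_le {β : ℝ} (hβ0 : 0 ≤ β) (hβ1 : β ≤ 1) {s : ℝ} (hs : 0 < s) :
    |eta s| ≤ 12 * (48 * Real.exp 1) * s ^ (-β) := by
  refine le_mul_rpow_neg_of_le_cubic_mul_exp hβ0 hβ1 hs (by norm_num) ?_
  rw [eta, abs_mul, Real.abs_exp]
  gcongr
  have hy : 0 ≤ π * s ^ 2 := by positivity
  generalize hdef : π * s ^ 2 = y at *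
  rw [show 8 * π * s ^ 2 * (y - 3 / 2) = 8 * y * (y - 3 / 2) by rw [← hdef]; ring, abs_le]
  constructor <;> nlinarith [pow_nonneg hy 2, pow_nonneg hy 3]

/-- The function `s ↦ s·η'(s)`. -/
noncomputable def mulDerivEta (s : ℝ) : ℝ :=
  8 * π * s ^ 2 * (7 * π * s ^ 2 - 3 - 2 * (π * s ^ 2) ^ 2) * Real.exp (-π * s ^ 2)

lemma abs_mulDerivEta_le {β : ℝ} (hβ0 : 0 ≤ β) (hβ1 : β ≤ 1) {s : ℝ} (hs : 0 < s) :
    |mulDerivEta s| ≤ 56 * (48 * Real.exp 1) * s ^ (-β) := by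
  refine le_mul_rpow_neg_of_le_cubic_mul_exp hβ0 hβ1 hs (by norm_num) ?_
  rw [mulDerivEta, abs_mul, Real.abs_exp]
  gcongr
  have hy : 0 ≤ π * s ^ 2 := by positivity
  rw [show 7 * π * s ^ 2 = 7 * (π * s ^ 2) by ring]
  generalize hdef : π * s ^ 2 = y at *
  rw [show 8 * π * s ^ 2 * (7 * y - 3 - 2 * y ^ 2) = 8 * y * (7 * y - 3 - 2 * y ^ 2) by
    rw [← hdef]; ring, abs_le]
  constructor <;> nlinarith [pow_nonneg hy 2, pow_nonneg hy 3]

lemma hasDerivAt_eta {s : ℝ} (hs : s ≠ 0) : HasDerivAt eta (mulDerivEta s / s) s := by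
  have hsq : HasDerivAt (fun x : ℝ => x ^ 2) (2 * s) s := by simpa using hasDerivAt_pow 2 s
  have := (((hsq.const_mul (8 * π)).mul ((hsq.const_mul π).sub_const (3 / 2))).mul
    (hsq.const_mul (-π)).exp)
  refine this.congr_deriv ?_
  simp only [mulDerivEta, Pi.mul_apply]
  field_simp
  ring

lemma continuous_eta : Continuous eta := by unfold eta; fun_prop

lemma continuous_mulDerivEta : Continuous mulDerivEta := by unfold mulDerivEta; fun_prop

lemma norm_eta_mul_cpow_le {ρ : ℂ} {β : ℝ} (hβ0 : 0 ≤ β) (hβ1 : β ≤ 1) {s u : ℝ}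
    (hs : 0 < s) (hu : 0 < u) :
    ‖(eta (u * s) : ℂ) * (u : ℂ) ^ (ρ - 1)‖
      ≤ 12 * (48 * Real.exp 1) * s ^ (-β) * u ^ (ρ.re - 1 - β) := by
  rw [norm_mul, Complex.norm_real, Complex.norm_cpow_eq_rpow_re_of_pos hu, Real.norm_eq_abs]
  calc |eta (u * s)| * u ^ (ρ - 1).re
      ≤ 12 * (48 * Real.exp 1) * (u * s) ^ (-β) * u ^ (ρ - 1).re := by
        gcongr; exact abs_eta_le hβ0 hβ1 (mul_pos hu hs)
    _ = _ := by
        rw [Real.mul_rpow hu.le hs.le, sub_eq_add_neg (ρ.re - 1), Real.rpow_add hu]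
        simp only [Complex.sub_re, Complex.one_re]
        ring

lemma integrableOn_eta_mul_cpow {ρ : ℂ} (hρ : ρ.re < 1) {s a : ℝ} (hs : 0 < s) (ha : 0 < a) :
    IntegrableOn (fun u : ℝ => (eta (u * s) : ℂ) * (u : ℂ) ^ (ρ - 1)) (Set.Ioi a) := by
  refine Integrable.mono' ((integrableOn_Ioi_rpow_of_lt (a := ρ.re - 1 - 1) (by linarith)
    ha).const_mul (12 * (48 * Real.exp 1) * s ^ (-1 : ℝ))) ?_ ?_
  · refine ContinuousOn.aestronglyMeasurable (fun u hu => ?_) measurableSet_Ioi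
    have hu0 : 0 < u := ha.trans hu
    refine ContinuousAt.continuousWithinAt (ContinuousAt.mul ?_ ?_)
    · exact (Complex.continuous_ofReal.comp
        (continuous_eta.comp (continuous_id.mul continuous_const))).continuousAt
    · exact Complex.continuousAt_ofReal_cpow_const _ _ (Or.inr hu0.ne')
  · refine (ae_restrict_iff' measurableSet_Ioi).2 (Eventually.of_forall fun u hu => ?_)
    exact norm_eta_mul_cpow_le zero_le_one le_rfl hs (ha.trans hu)

lemma norm_g_le {ρ : ℂ} {β : ℝ} (hβ0 : 0 ≤ β) (hρβ : ρ.re < β) (hβ1 : β ≤ 1) {s : ℝ}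
    (hs : 0 < s) :
    ‖g ρ s‖ ≤ 12 * (48 * Real.exp 1) / (β - ρ.re) * s ^ (-β) := by
  have hint := (integrableOn_Ioi_rpow_of_lt (a := ρ.re - 1 - β) (by linarith)
    one_pos).const_mul (12 * (48 * Real.exp 1) * s ^ (-β))
  refine (norm_integral_le_of_norm_le hint
    ((ae_restrict_iff' measurableSet_Ioi).2 (Eventually.of_forall fun u hu =>
      norm_eta_mul_cpow_le hβ0 hβ1 hs (one_pos.trans hu)))).trans_eq ?_
  rw [integral_const_mul, integral_Ioi_rpow_of_lt (by linarith) one_pos, Real.one_rpow]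
  rw [show ρ.re - 1 - β + 1 = -(β - ρ.re) by ring, neg_div_neg_eq]
  ring

lemma g_eq_cpow_mul_integral (ρ : ℂ) {t : ℝ} (ht : 0 < t) :
    g ρ t = (t : ℂ) ^ (-ρ) * ∫ v in Set.Ioi t, (eta v : ℂ) * (v : ℂ) ^ (ρ - 1) := by
  have h := integral_comp_mul_left_Ioi
    (fun v : ℝ => (eta v : ℂ) * (v : ℂ) ^ (ρ - 1)) 1 ht
  rw [mul_one] at h
  have ht0 : (t : ℂ) ≠ 0 := by exact_mod_cast ht.ne'
  rw [← (eq_inv_smul_iff₀ ht.ne').1 h, g, ← integral_smul, ← integral_const_mul]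
  refine setIntegral_congr_fun measurableSet_Ioi fun u hu => ?_
  have hu0 : 0 < u := one_pos.trans hu
  simp only [Complex.real_smul]
  rw [Complex.ofReal_mul, Complex.mul_cpow_ofReal_nonneg ht.le hu0.le, mul_comm u t,
    Complex.cpow_sub _ _ ht0, Complex.cpow_neg, Complex.cpow_one]
  have : (t : ℂ) ^ ρ ≠ 0 := by simp [Complex.cpow_eq_zero_iff, ht0]
  field_simp

lemma hasDerivAt_g {ρ : ℂ} (hρ : ρ.re < 1) {t : ℝ} (ht : 0 < t) :
    HasDerivAt (g ρ) ((-ρ * g ρ t - eta t) / t) t := by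
  set f : ℝ → ℂ := fun v => (eta v : ℂ) * (v : ℂ) ^ (ρ - 1) with hf
  have ht0 : (t : ℂ) ≠ 0 := by exact_mod_cast ht.ne'
  have hfi : ∀ a : ℝ, 0 < a → IntegrableOn f (Set.Ioi a) := fun a ha => by
    simpa using integrableOn_eta_mul_cpow hρ one_pos ha
  have hfc : ∀ v : ℝ, 0 < v → ContinuousAt f v := fun v hv =>
    (Complex.continuous_ofReal.comp continuous_eta).continuousAt.mul
      (Complex.continuousAt_ofReal_cpow_const _ _ (Or.inr hv.ne'))
  have hii : ∀ a b : ℝ, 0 < a → 0 < b → IntervalIntegrable f volume a b := fun a b ha hb =>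
    ContinuousOn.intervalIntegrable fun v hv =>
      (hfc v ((lt_min ha hb).trans_le hv.1)).continuousWithinAt
  have htail : HasDerivAt (fun s => ∫ v in Set.Ioi s, f v) (-f t) t := by
    have hprim : HasDerivAt (fun s => ∫ v in (1 : ℝ)..s, f v) (f t) t :=
      intervalIntegral.integral_hasDerivAt_right (hii 1 t one_pos ht)
        (ContinuousOn.stronglyMeasurableAtFilter isOpen_Ioi
          (fun v hv => (hfc v hv).continuousWithinAt) t (Set.mem_Ioi.2 ht)) (hfc t ht)
    refine (hprim.const_sub (∫ v in Set.Ioi (1 : ℝ), f v)).congr_of_eventuallyEq ?_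
    filter_upwards [lt_mem_nhds ht] with s hs
    rw [← intervalIntegral.integral_interval_add_Ioi (hfi 1 one_pos) (hfi s hs)]
    ring
  have hpow : HasDerivAt (fun s : ℝ => (s : ℂ) ^ (-ρ)) (-ρ * (t : ℂ) ^ (-ρ - 1)) t := by
    simpa using (Complex.hasStrictDerivAt_cpow_const (x := (t : ℂ)) (c := -ρ)
      (Complex.ofReal_mem_slitPlane.2 ht)).hasDerivAt.comp_ofReal
  refine ((hpow.mul htail).congr_of_eventuallyEq ?_).congr_deriv ?_
  · filter_upwards [lt_mem_nhds ht] with s hs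
    exact g_eq_cpow_mul_integral ρ hs
  · rw [g_eq_cpow_mul_integral ρ ht, hf]
    have : (t : ℂ) ^ ρ ≠ 0 := by simp [Complex.cpow_eq_zero_iff, ht0]
    simp only [Complex.cpow_sub _ _ ht0, Complex.cpow_neg, Complex.cpow_one]
    field_simp
    ring

/-- Two integrations by parts against `sin (a t)`, starting at a zero of `cos (a t)`. -/
lemma norm_integral_Ioi_mul_sin_le {h h₁ h₂ : ℝ → ℂ} {a c : ℝ} (ha : 0 < a)
    (hcos : Real.cos (a * c) = 0)
    (hd : ∀ t ∈ Set.Ici c, HasDerivAt h (h₁ t) t)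
    (hd₁ : ∀ t ∈ Set.Ici c, HasDerivAt h₁ (h₂ t) t)
    (hi : IntegrableOn h (Set.Ioi c)) (hi₂ : IntegrableOn h₂ (Set.Ioi c))
    (ht : Tendsto h atTop (nhds 0)) (ht₁ : Tendsto h₁ atTop (nhds 0)) :
    ‖∫ t in Set.Ioi c, h t * (Real.sin (a * t) : ℂ)‖
      ≤ (‖h₁ c‖ + ∫ t in Set.Ioi c, ‖h₂ t‖) / a ^ 2 := by
  have haC : (a : ℂ) ≠ 0 := by exact_mod_cast ha.ne'
  have hlin : ∀ t : ℝ, HasDerivAt (fun t : ℝ => a * t) a t := fun t => by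
    simpa using (hasDerivAt_id t).const_mul a
  have hs : ∀ t : ℝ, HasDerivAt (fun t : ℝ => (Real.sin (a * t) : ℂ))
      ((Real.cos (a * t) * a : ℝ) : ℂ) t := fun t => (hlin t).sin.ofReal_comp
  have hc : ∀ t : ℝ, HasDerivAt (fun t : ℝ => (Real.cos (a * t) : ℂ))
      ((-Real.sin (a * t) * a : ℝ) : ℂ) t := fun t => (hlin t).cos.ofReal_comp
  have hsin_meas : AEStronglyMeasurable (fun t : ℝ => (Real.sin (a * t) : ℂ))
      (volume.restrict (Set.Ioi c)) :=
    Continuous.aestronglyMeasurable (by fun_prop)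
  have hsin_le : ∀ t : ℝ, ‖(Real.sin (a * t) : ℂ)‖ ≤ 1 := fun t => by
    rw [Complex.norm_real]; exact Real.abs_sin_le_one _
  have hcos_le : ∀ t : ℝ, ‖(Real.cos (a * t) : ℂ)‖ ≤ 1 := fun t => by
    rw [Complex.norm_real]; exact Real.abs_cos_le_one _
  have his : IntegrableOn (fun t => h t * (Real.sin (a * t) : ℂ)) (Set.Ioi c) :=
    hi.mul_bdd hsin_meas (Eventually.of_forall hsin_le)
  have his₂ : IntegrableOn (fun t => h₂ t * (Real.sin (a * t) : ℂ)) (Set.Ioi c) :=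
    hi₂.mul_bdd hsin_meas (Eventually.of_forall hsin_le)
  have htendsto : ∀ {k : ℝ → ℂ} {w : ℝ → ℂ}, Tendsto k atTop (nhds 0) → (∀ t, ‖w t‖ ≤ 1) →
      Tendsto (fun t => k t * w t) atTop (nhds 0) := fun {k w} hk hw =>
    squeeze_zero_norm (fun t => by
      rw [norm_mul]; exact mul_le_of_le_one_right (norm_nonneg _) (hw t)) (tendsto_zero_iff_norm_tendsto_zero.1 hk)
  have hftc := integral_Ioi_of_hasDerivAt_of_tendsto'
    (f := fun t => h₁ t * (Real.sin (a * t) : ℂ) / (a : ℂ) ^ 2 -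
      h t * (Real.cos (a * t) : ℂ) / (a : ℂ))
    (f' := fun t => h t * (Real.sin (a * t) : ℂ) +
      h₂ t * (Real.sin (a * t) : ℂ) / (a : ℂ) ^ 2) (a := c) (m := 0)
    (fun t htc => by
      refine ((((hd₁ t htc).mul (hs t)).div_const _).sub
        (((hd t htc).mul (hc t)).div_const _)).congr_deriv ?_
      push_cast
      field_simp
      ring)
    (his.add (his₂.div_const _))
    (by simpa using ((htendsto ht₁ hsin_le).div_const ((a : ℂ) ^ 2)).sub
          ((htendsto ht hcos_le).div_const (a : ℂ)))
  rw [integral_add his (his₂.div_const _), integral_div, hcos] at hftc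
  have heq : ∫ t in Set.Ioi c, h t * (Real.sin (a * t) : ℂ) =
      -((h₁ c * (Real.sin (a * c) : ℂ) +
        ∫ t in Set.Ioi c, h₂ t * (Real.sin (a * t) : ℂ)) / (a : ℂ) ^ 2) := by
    rw [eq_sub_of_add_eq hftc]
    simp
    ring
  rw [heq, norm_neg, norm_div, norm_pow, Complex.norm_real, Real.norm_of_nonneg ha.le]
  gcongr
  refine (norm_add_le _ _).trans (add_le_add ?_ ?_)
  · rw [norm_mul]; exact mul_le_of_le_one_right (norm_nonneg _) (hsin_le c)
  · refine norm_integral_le_of_norm_le hi₂.norm (Eventually.of_forall fun t => ?_)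
    rw [norm_mul]; exact mul_le_of_le_one_right (norm_nonneg _) (hsin_le t)

lemma norm_div_pow_le_of_norm_le_rpow {z : ℂ} {N β x t : ℝ} (hx : 0 < x) (ht : 0 < t) (k : ℕ)
    (hz : ‖z‖ ≤ N * (x * t) ^ (-β)) : ‖z / (t : ℂ) ^ k‖ ≤ N * x ^ (-β) * t ^ (-β - k) := by
  rw [norm_div, norm_pow, Complex.norm_real, Real.norm_of_nonneg ht.le, div_le_iff₀ (by positivity),
    Real.rpow_sub ht, Real.rpow_natCast]
  rw [Real.mul_rpow hx.le ht.le] at hz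
  refine hz.trans_eq ?_
  field_simp

/-- The quadratic decay in the frequency, for every decay exponent `β ∈ (Re ρ, 1]` in `x`. -/
lemma exists_norm_integral_g_mul_sin_le {ρ : ℂ} {β : ℝ} (hβ0 : 0 < β) (hρβ : ρ.re < β)
    (hβ1 : β ≤ 1) :
    ∃ C : ℝ, 0 ≤ C ∧ ∀ l : ℕ, ∀ x : ℝ, 0 < x →
      ‖∫ t in Set.Ioi (1 / 2 : ℝ),
          g ρ (x * t) * ((Real.sin ((2 * (l : ℝ) + 1) * π * t) / (π * t) : ℝ) : ℂ)‖
        ≤ C * x ^ (-β) / (2 * l + 1) ^ 2 := by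
  have hρ : ρ.re < 1 := hρβ.trans_le hβ1
  obtain ⟨M, hM, hg, he, hm⟩ : ∃ M : ℝ, 0 ≤ M ∧ (∀ s, 0 < s → ‖g ρ s‖ ≤ M * s ^ (-β)) ∧
      (∀ s, 0 < s → ‖(eta s : ℂ)‖ ≤ M * s ^ (-β)) ∧
      (∀ s, 0 < s → ‖(mulDerivEta s : ℂ)‖ ≤ M * s ^ (-β)) := by
    have hβρ : 0 < β - ρ.re := sub_pos.2 hρβ
    refine ⟨12 * (48 * Real.exp 1) / (β - ρ.re) + 12 * (48 * Real.exp 1) +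
      56 * (48 * Real.exp 1), by positivity, fun s hs => ?_, fun s hs => ?_, fun s hs => ?_⟩
    · refine (norm_g_le hβ0.le hρβ hβ1 hs).trans ?_
      gcongr
      rw [add_assoc]
      exact le_add_of_nonneg_right (by positivity)
    · rw [Complex.norm_real]
      refine (abs_eta_le hβ0.le hβ1 hs).trans ?_
      gcongr
      have : 0 ≤ 12 * (48 * Real.exp 1) / (β - ρ.re) := by positivity
      linarith [Real.exp_pos 1]
    · rw [Complex.norm_real]
      refine (abs_mulDerivEta_le hβ0.le hβ1 hs).trans ?_
      gcongr
      exact le_add_of_nonneg_left (by positivity)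
  set q₁ : ℝ → ℂ := fun s => -(ρ + 1) * g ρ s - eta s with hq₁
  set q₂ : ℝ → ℂ := fun s => (ρ + 1) * (ρ + 2) * g ρ s + (ρ + 3) * eta s - mulDerivEta s
    with hq₂
  set N₁ : ℝ := (‖ρ + 1‖ + 1) * M with hN₁
  set N₂ : ℝ := (‖ρ + 1‖ * ‖ρ + 2‖ + ‖ρ + 3‖ + 1) * M with hN₂
  have hq₁_le : ∀ s, 0 < s → ‖q₁ s‖ ≤ N₁ * s ^ (-β) := fun s hs => by
    refine (norm_sub_le _ _).trans ?_
    rw [norm_mul, norm_neg]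
    calc ‖ρ + 1‖ * ‖g ρ s‖ + ‖(eta s : ℂ)‖
        ≤ ‖ρ + 1‖ * (M * s ^ (-β)) + M * s ^ (-β) := by
          gcongr
          exacts [hg s hs, he s hs]
      _ = N₁ * s ^ (-β) := by rw [hN₁]; ring
  have hq₂_le : ∀ s, 0 < s → ‖q₂ s‖ ≤ N₂ * s ^ (-β) := fun s hs => by
    refine (norm_sub_le _ _).trans ((add_le_add_left (norm_add_le _ _) _).trans ?_)
    rw [norm_mul, norm_mul, norm_mul]
    calc ‖ρ + 1‖ * ‖ρ + 2‖ * ‖g ρ s‖ + ‖ρ + 3‖ * ‖(eta s : ℂ)‖ + ‖(mulDerivEta s : ℂ)‖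
        ≤ ‖ρ + 1‖ * ‖ρ + 2‖ * (M * s ^ (-β)) + ‖ρ + 3‖ * (M * s ^ (-β)) + M * s ^ (-β) := by
          gcongr
          exacts [hg s hs, he s hs, hm s hs]
      _ = N₂ * s ^ (-β) := by rw [hN₂]; ring
  set J : ℝ := ∫ t in Set.Ioi (1 / 2 : ℝ), t ^ (-β - (3 : ℕ)) with hJ
  have hJ0 : 0 ≤ J := setIntegral_nonneg measurableSet_Ioi fun t ht =>
    Real.rpow_nonneg (by have := Set.mem_Ioi.1 ht; linarith) _
  refine ⟨(N₁ * (1 / 2) ^ (-β - (2 : ℕ)) + N₂ * J) / π ^ 3, by positivity, fun l x hx => ?_⟩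
  have hpos : ∀ t ∈ Set.Ici (1 / 2 : ℝ), 0 < t := fun t ht => one_half_pos.trans_le ht
  have hgd : ∀ t : ℝ, 0 < t → HasDerivAt (fun t => g ρ (x * t))
      ((-ρ * g ρ (x * t) - eta (x * t)) / t) t := fun t ht => by
    have hxt : HasDerivAt (fun t : ℝ => x * t) x t := by
      simpa using (hasDerivAt_id t).const_mul x
    refine ((hasDerivAt_g hρ (mul_pos hx ht)).scomp t hxt).congr_deriv ?_
    have hxC : (x : ℂ) ≠ 0 := by exact_mod_cast hx.ne'
    have htC : (t : ℂ) ≠ 0 := by exact_mod_cast ht.ne'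
    rw [Complex.real_smul]
    push_cast
    field_simp
  have hed : ∀ t : ℝ, 0 < t → HasDerivAt (fun t => (eta (x * t) : ℂ))
      (mulDerivEta (x * t) / t) t := fun t ht => by
    have hxt : HasDerivAt (fun t : ℝ => x * t) x t := by
      simpa using (hasDerivAt_id t).const_mul x
    refine (((hasDerivAt_eta (mul_pos hx ht).ne').comp t hxt).ofReal_comp).congr_deriv ?_
    have hxC : (x : ℂ) ≠ 0 := by exact_mod_cast hx.ne'
    have htC : (t : ℂ) ≠ 0 := by exact_mod_cast ht.ne'
    push_cast
    field_simp
  have hpow : ∀ (k : ℕ) (t : ℝ), HasDerivAt (fun t : ℝ => (t : ℂ) ^ k)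
      (k * (t : ℂ) ^ (k - 1)) t := fun k t => (hasDerivAt_pow k (t : ℂ)).comp_ofReal
  have hd : ∀ t ∈ Set.Ici (1 / 2 : ℝ), HasDerivAt (fun t : ℝ => g ρ (x * t) / (t : ℂ) ^ 1)
      (q₁ (x * t) / (t : ℂ) ^ 2) t := fun t ht => by
    have htC : (t : ℂ) ≠ 0 := by exact_mod_cast (hpos t ht).ne'
    refine ((hgd t (hpos t ht)).div (hpow 1 t) (pow_ne_zero _ htC)).congr_deriv ?_
    simp only [hq₁]
    field_simp
    push_cast
    ring
  have hd₁ : ∀ t ∈ Set.Ici (1 / 2 : ℝ), HasDerivAt (fun t : ℝ => q₁ (x * t) / (t : ℂ) ^ 2)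
      (q₂ (x * t) / (t : ℂ) ^ 3) t := fun t ht => by
    have htC : (t : ℂ) ≠ 0 := by exact_mod_cast (hpos t ht).ne'
    refine ((((hgd t (hpos t ht)).const_mul (-(ρ + 1))).sub (hed t (hpos t ht))).div
      (hpow 2 t) (pow_ne_zero _ htC)).congr_deriv ?_
    simp only [hq₂, Pi.sub_apply]
    field_simp
    push_cast
    ring
  have hint : ∀ {q : ℝ → ℂ} {N : ℝ} (k : ℕ), 1 ≤ k → (∀ s, 0 < s → ‖q s‖ ≤ N * s ^ (-β)) →
      (∀ t : ℝ, 0 < t → ContinuousAt (fun t => q (x * t)) t) →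
      IntegrableOn (fun t : ℝ => q (x * t) / (t : ℂ) ^ k) (Set.Ioi (1 / 2)) := by
    intro q N k hk hq hqc
    have hk' : (1 : ℝ) ≤ k := by exact_mod_cast hk
    refine Integrable.mono' ((integrableOn_Ioi_rpow_of_lt (a := -β - k) (by linarith)
      one_half_pos).const_mul (N * x ^ (-β))) ?_ ?_
    · refine ContinuousOn.aestronglyMeasurable (fun t ht => ?_) measurableSet_Ioi
      have ht0 := hpos t (Set.Ioi_subset_Ici_self ht)
      exact ((hqc t ht0).div (by fun_prop)
        (pow_ne_zero _ (by exact_mod_cast ht0.ne'))).continuousWithinAt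
    · refine (ae_restrict_iff' measurableSet_Ioi).2 (Eventually.of_forall fun t ht => ?_)
      have ht0 := hpos t (Set.Ioi_subset_Ici_self ht)
      exact norm_div_pow_le_of_norm_le_rpow hx ht0 k (hq _ (mul_pos hx ht0))
  have hlim : ∀ {q : ℝ → ℂ} {N : ℝ} (k : ℕ), (∀ s, 0 < s → ‖q s‖ ≤ N * s ^ (-β)) →
      Tendsto (fun t : ℝ => q (x * t) / (t : ℂ) ^ k) atTop (nhds 0) := by
    intro q N k hq
    refine squeeze_zero_norm' (a := fun t : ℝ => N * x ^ (-β) * t ^ (-(β + k))) ?_ ?_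
    · filter_upwards [eventually_gt_atTop 0] with t ht
      rw [neg_add']
      exact norm_div_pow_le_of_norm_le_rpow hx ht k (hq _ (mul_pos hx ht))
    · simpa using (tendsto_rpow_neg_atTop (y := β + k) (by positivity)).const_mul
        (N * x ^ (-β))
  have hq₂c : ∀ t : ℝ, 0 < t → ContinuousAt (fun t => q₂ (x * t)) t := fun t ht =>
    ((continuousAt_const.mul (hgd t ht).continuousAt).add
      (continuousAt_const.mul (hed t ht).continuousAt)).sub
      (Complex.continuous_ofReal.comp
        (continuous_mulDerivEta.comp (continuous_const.mul continuous_id))).continuousAt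
  have ha : 0 < (2 * (l : ℝ) + 1) * π := by positivity
  have hcos : Real.cos ((2 * (l : ℝ) + 1) * π * (1 / 2)) = 0 := by
    rw [Real.cos_eq_zero_iff]
    exact ⟨l, by push_cast; ring⟩
  have hi₂ := hint 3 (by norm_num) hq₂_le hq₂c
  have hmain := norm_integral_Ioi_mul_sin_le ha hcos hd hd₁
    (hint 1 le_rfl hg fun t ht => (hgd t ht).continuousAt) hi₂ (hlim 1 hg) (hlim 2 hq₁_le)
  have hrw : ∫ t in Set.Ioi (1 / 2 : ℝ),
        g ρ (x * t) * ((Real.sin ((2 * (l : ℝ) + 1) * π * t) / (π * t) : ℝ) : ℂ) =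
      (π : ℂ)⁻¹ * ∫ t in Set.Ioi (1 / 2 : ℝ), g ρ (x * t) / (t : ℂ) ^ 1 *
        (Real.sin ((2 * (l : ℝ) + 1) * π * t) : ℂ) := by
    rw [← integral_const_mul]
    congr 1 with t
    rw [Complex.ofReal_div, Complex.ofReal_mul, pow_one, div_eq_mul_inv, mul_inv]
    ring
  have hbdry := norm_div_pow_le_of_norm_le_rpow hx one_half_pos 2
    (hq₁_le _ (mul_pos hx one_half_pos))
  have htail : ∫ t in Set.Ioi (1 / 2 : ℝ), ‖q₂ (x * t) / (t : ℂ) ^ 3‖ ≤ N₂ * x ^ (-β) * J := by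
    rw [hJ, ← integral_const_mul]
    refine setIntegral_mono_on hi₂.norm ((integrableOn_Ioi_rpow_of_lt
      (by push_cast; linarith) one_half_pos).const_mul _) measurableSet_Ioi fun t ht => ?_
    have ht0 := hpos t (Set.Ioi_subset_Ici_self ht)
    exact norm_div_pow_le_of_norm_le_rpow hx ht0 3 (hq₂_le _ (mul_pos hx ht0))
  rw [hrw, norm_mul, norm_inv, Complex.norm_real, Real.norm_of_nonneg pi_pos.le]
  calc π⁻¹ * _ ≤ π⁻¹ * ((N₁ * x ^ (-β) * (1 / 2) ^ (-β - (2 : ℕ)) + N₂ * x ^ (-β) * J) /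
        ((2 * (l : ℝ) + 1) * π) ^ 2) := by
        gcongr
        exact hmain.trans (by gcongr)
    _ = _ := by
        field_simp

theorem stmt_17 (ρ : ℂ) (hζ : riemannZeta ρ = 0) (hρ0 : 0 < ρ.re) (hρ1 : ρ.re < 1 / 2)
    (ε : ℝ) (hε0 : 0 < ε) (hε1 : ε < 1 / 2 - ρ.re) :
    ∃ C > (0 : ℝ), ∀ l : ℕ, 0 < l → ∀ x : ℝ, 0 < x →
      (x ≤ 1 →
        ‖∫ t in Set.Ioi (1 / 2 : ℝ),
            g ρ (x * t) * ((Real.sin ((2 * (l : ℝ) + 1) * π * t) / (π * t) : ℝ) : ℂ)‖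
          ≤ C * x ^ (-ρ.re - ε) / (2 * l + 1) ^ 2)
      ∧ (1 < x →
        ‖∫ t in Set.Ioi (1 / 2 : ℝ),
            g ρ (x * t) * ((Real.sin ((2 * (l : ℝ) + 1) * π * t) / (π * t) : ℝ) : ℂ)‖
          ≤ C * x⁻¹ / (2 * l + 1) ^ 2) := by
  obtain ⟨A, hA0, hA⟩ := exists_norm_integral_g_mul_sin_le (ρ := ρ) (β := ρ.re + ε)
    (by linarith) (by linarith) (by linarith)
  obtain ⟨B, hB0, hB⟩ := exists_norm_integral_g_mul_sin_le (ρ := ρ) (β := 1)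
    one_pos (by linarith) le_rfl
  refine ⟨A + B + 1, by positivity, fun l _ x hx => ⟨fun _ => ?_, fun _ => ?_⟩⟩
  · refine (hA l x hx).trans ?_
    rw [neg_add']
    gcongr
    linarith
  · refine (hB l x hx).trans ?_
    rw [Real.rpow_neg_one]
    gcongr
    linarith
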